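/- For k ∈ {1,2,3}, let Γ′ be a G_k-prebrick and Γ := φ_k⁻¹(Γ′) (a G-prebrick). Then for every m ∈ ℤ³, wt_{Γ′}(φ_k(m)) = φ_k(wt_Γ(m)). -/

import Mathlib

noncomputable section

open Classical

/-- The lattice `ℤ³` of exponents of Laurent monomials in `x, y, z` (written additively). -/
abbrev V3 : Type := Fin 3 → ℤ

/-- The standard basis vectors `e₁, e₂, e₃` (indices `0, 1, 2`). -/
def ee (i : Fin 3) : V3 := Pi.single i 1

/-- `n` is a genuine monomial, i.e. `n ∈ ℕ³ ⊆ ℤ³`. -/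
def IsNat3 (n : V3) : Prop := ∀ i, 0 ≤ n i

/-- The weight map `w(m) = β₁m₁ + β₂m₂ + β₃m₃ (mod s)`. -/
def wmap (s : ℕ) (β : Fin 3 → ℤ) (m : V3) : ZMod s := ((∑ i, β i * m i : ℤ) : ZMod s)

/-- One step of a (fractional) monomial path inside `Γ`: multiply or divide
by one of `x, y, z`, staying in `Γ`. -/
def StepRel (Γ : Set V3) (m m' : V3) : Prop :=
  m' ∈ Γ ∧ ∃ i : Fin 3, m' = m + ee i ∨ m' = m - ee i

/-- A prebrick with respect to the modulus `s` and the weights `β`. -/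
structure IsPrebrick (s : ℕ) (β : Fin 3 → ℤ) (Γ : Set V3) : Prop where
  zero_mem : (0 : V3) ∈ Γ
  bijOn : Set.BijOn (wmap s β) Γ Set.univ
  saturated : ∀ m ∈ Γ, ∀ n n' : V3, IsNat3 n → IsNat3 n' → n' + n + m ∈ Γ → n + m ∈ Γ
  connected : ∀ m ∈ Γ, Relation.ReflTransGen (StepRel Γ) m 0

/-- `wtG s β Γ m` is the unique element of `Γ` with the same weight as `m`
(when `Γ` is a prebrick). -/
noncomputable def wtG (s : ℕ) (β : Fin 3 → ℤ) (Γ : Set V3) (m : V3) : V3 :=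
  Classical.epsilon fun g => g ∈ Γ ∧ wmap s β g = wmap s β m

/-- The monoid `S(Γ)`, generated by all `n + m − wt_Γ(n + m)`, `n ∈ ℕ³`, `m ∈ Γ`. -/
def SG (s : ℕ) (β : Fin 3 → ℤ) (Γ : Set V3) : AddSubmonoid V3 :=
  AddSubmonoid.closure
    {v | ∃ n m : V3, IsNat3 n ∧ m ∈ Γ ∧ v = n + m - wtG s β Γ (n + m)}

/-- A brick: a prebrick with `S(Γ) ∩ (−S(Γ)) = {0}`. -/
def IsBrick (s : ℕ) (β : Fin 3 → ℤ) (Γ : Set V3) : Prop :=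
  IsPrebrick s β Γ ∧ ∀ v ∈ SG s β Γ, -v ∈ SG s β Γ → v = 0

/-- `d(m) = m₁ + a·m₂ + (r−a)·m₃`. -/
def dd (r a : ℕ) (m : V3) : ℤ := m 0 + (a : ℤ) * m 1 + ((r : ℤ) - (a : ℤ)) * m 2

/-- The round down functions of the weighted blowup with weight `(1, a, r−a)`:
`phiRD r a 0 = φ₁` (central), `phiRD r a 1 = φ₂` (left), `phiRD r a 2 = φ₃` (right);
the `k`-th coordinate is replaced by `⌊d(m)/r⌋`. -/
def phiRD (r a : ℕ) (k : Fin 3) (m : V3) : V3 :=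
  Function.update m k ((dd r a m).fdiv (r : ℤ))

/-- Weights `(1, a, r−a)` of the group `G` of type `(1/r)(1, a, r−a)`. -/
def wtsG (r a : ℕ) : Fin 3 → ℤ := ![1, (a : ℤ), (r : ℤ) - (a : ℤ)]

/-- Moduli of the groups `G₁` (trivial), `G₂` of type `(1/a)(1,−r,r)` and
`G₃` of type `(1/(r−a))(1,r,−r)`. -/
def gkMod (r a : ℕ) : Fin 3 → ℕ := ![1, a, r - a]

/-- Weights of the groups `G₁, G₂, G₃`. -/
def gkWts (r a : ℕ) : Fin 3 → Fin 3 → ℤ :=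
  ![![0, 0, 0], ![1, -(r : ℤ), (r : ℤ)], ![1, (r : ℤ), -(r : ℤ)]]

/-- Two vectors have the same weight exactly when their `ℤ`-valued weights are congruent. -/
lemma wmap_eq_iff (s : ℕ) (β : Fin 3 → ℤ) (u v : V3) :
    wmap s β u = wmap s β v ↔
      (s : ℤ) ∣ β 0 * (v 0 - u 0) + β 1 * (v 1 - u 1) + β 2 * (v 2 - u 2) := by
  rw [wmap, wmap, ZMod.intCast_eq_intCast_iff_dvd_sub, Fin.sum_univ_three, Fin.sum_univ_three]
  exact iff_of_eq (congrArg _ (by ring))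

lemma wmap_wtsG_eq_iff (r a : ℕ) (u v : V3) :
    wmap r (wtsG r a) u = wmap r (wtsG r a) v ↔ ∃ t, dd r a v = dd r a u + r * t := by
  rw [wmap_eq_iff]
  simp only [wtsG, dd, Matrix.cons_val]
  exact exists_congr fun t => ⟨fun h => by linarith, fun h => by linarith⟩

lemma dd_fdiv_of_eq_add {r a : ℕ} (hr : 0 < r) {u v : V3} {t : ℤ}
    (h : dd r a v = dd r a u + r * t) :
    (dd r a v).fdiv r = (dd r a u).fdiv r + t := by
  rw [h, Int.add_mul_fdiv_left _ _ (by omega)]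

/-- The round down function maps vectors of equal `G`-weight to vectors of equal `G_k`-weight. -/
lemma wmap_phiRD_eq {r a : ℕ} (h2 : a < r) (k : Fin 3) {u v : V3}
    (h : wmap r (wtsG r a) u = wmap r (wtsG r a) v) :
    wmap (gkMod r a k) (gkWts r a k) (phiRD r a k u) =
      wmap (gkMod r a k) (gkWts r a k) (phiRD r a k v) := by
  obtain ⟨t, ht⟩ := (wmap_wtsG_eq_iff r a u v).1 h
  have hf := dd_fdiv_of_eq_add (by omega) ht
  rw [wmap_eq_iff]
  simp only [dd] at ht
  fin_cases k
  · simp [gkMod]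
  · simp only [phiRD, hf]
    simp [gkMod, gkWts]
    exact ⟨(v 2 - u 2) - (v 1 - u 1), by linear_combination ht⟩
  · simp only [phiRD, hf]
    simp [gkMod, gkWts, Nat.cast_sub h2.le]
    exact ⟨(v 1 - u 1) - (v 2 - u 2), by linear_combination ht⟩

/-- Every vector of the same `G_k`-weight as `phiRD r a k m` is the round down of a vector of the
same `G`-weight as `m`. -/
lemma exists_phiRD_eq {r a : ℕ} (h2 : a < r) (k : Fin 3) {m h : V3}
    (hw : wmap (gkMod r a k) (gkWts r a k) (phiRD r a k m) =
      wmap (gkMod r a k) (gkWts r a k) h) :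
    ∃ g, phiRD r a k g = h ∧ wmap r (wtsG r a) g = wmap r (wtsG r a) m := by
  suffices H : ∃ x, dd r a (Function.update h k x) =
      dd r a m + r * (h k - (dd r a m).fdiv r) by
    obtain ⟨x, hx⟩ := H
    refine ⟨Function.update h k x, ?_, ((wmap_wtsG_eq_iff r a _ _).2 ⟨_, hx⟩).symm⟩
    rw [phiRD, dd_fdiv_of_eq_add (by omega) hx]
    simp
  rw [wmap_eq_iff] at hw
  generalize hq : (dd r a m).fdiv r = q at *
  simp only [phiRD, hq] at hw
  fin_cases k
  · refine ⟨dd r a m + r * (h 0 - q) - a * h 1 - (r - a) * h 2, ?_⟩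
    simp [dd]
    ring
  · simp [gkMod, gkWts] at hw
    obtain ⟨c, hc⟩ := hw
    refine ⟨m 1 - c + (h 2 - m 2), ?_⟩
    simp [dd]
    linear_combination hc
  · simp [gkMod, gkWts, Nat.cast_sub h2.le] at hw
    obtain ⟨c, hc⟩ := hw
    refine ⟨m 2 - c + (h 1 - m 1), ?_⟩
    simp [dd]
    linear_combination hc

lemma wtG_spec {s : ℕ} {β : Fin 3 → ℤ} {Γ : Set V3} {m : V3}
    (h : ∃ g, g ∈ Γ ∧ wmap s β g = wmap s β m) :
    wtG s β Γ m ∈ Γ ∧ wmap s β (wtG s β Γ m) = wmap s β m :=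
  Classical.epsilon_spec h

lemma IsPrebrick.wtG_spec {s : ℕ} {β : Fin 3 → ℤ} {Γ : Set V3} (hΓ : IsPrebrick s β Γ) (m : V3) :
    wtG s β Γ m ∈ Γ ∧ wmap s β (wtG s β Γ m) = wmap s β m :=
  _root_.wtG_spec (hΓ.bijOn.surjOn (Set.mem_univ (wmap s β m)))

/-- Lemma 4.5 of the paper: `wt_{Γ′}(φ_k(m)) = φ_k(wt_Γ(m))`. -/
theorem wt_phiRD_comm (r a : ℕ) (h1 : 0 < a) (h2 : a < r) (hcop : Nat.Coprime r a)
    (k : Fin 3) (Γ' : Set V3) (h' : IsPrebrick (gkMod r a k) (gkWts r a k) Γ') (m : V3) :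
    wtG (gkMod r a k) (gkWts r a k) Γ' (phiRD r a k m) =
      phiRD r a k (wtG r (wtsG r a) (phiRD r a k ⁻¹' Γ') m) := by
  obtain ⟨hmem, hwt⟩ := h'.wtG_spec (phiRD r a k m)
  obtain ⟨g, hg, hgw⟩ := exists_phiRD_eq h2 k hwt.symm
  obtain ⟨gmem, gwt⟩ :=
    wtG_spec (Γ := phiRD r a k ⁻¹' Γ') ⟨g, by rwa [Set.mem_preimage, hg], hgw⟩
  exact h'.bijOn.injOn hmem gmem (hwt.trans (wmap_phiRD_eq h2 k gwt).symm)
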